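/- Let B₁, …, B₁₂ be the following twelve 7-element subsets of ℤ/505ℤ: {0,1,3,7,119,242,341}, {0,5,51,63,95,254,287}, {0,8,261,297,369,388,417}, {0,9,26,85,357,428,490}, {0,10,170,310,391,455,492}, {0,11,93,113,279,384,422}, {0,14,161,290,368,421,477}, {0,16,89,158,273,327,453}, {0,18,45,79,217,304,371}, {0,21,43,149,206,317,456}, {0,25,135,175,328,375,450}, {0,30,227,258,324,431,470}. Then the difference sets ΔB₁, …, ΔB₁₂ are pairwise disjoint, each has cardinality 42, and their union is (ℤ/505ℤ) \ {0}; consequently the translates {Bᵢ + g : 1 ≤ i ≤ 12, g ∈ ℤ/505ℤ} form the block set of a Steiner system S(2,7,505) on ℤ/505ℤ. -/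

import Mathlib

/-- The set of differences `ΔB = {a - c : a, c ∈ B, a ≠ c}`. -/
def diffSet (B : Finset (ZMod 505)) : Finset (ZMod 505) :=
  ((B ×ˢ B).filter fun p => p.1 ≠ p.2).image fun p => p.1 - p.2

/-- The 12 base blocks of the difference family on `ZMod 505`. -/
def baseBlocks : Fin 12 → Finset (ZMod 505) :=
  ![({0,1,3,7,119,242,341} : Finset (ZMod 505)),
   ({0,5,51,63,95,254,287} : Finset (ZMod 505)),
   ({0,8,261,297,369,388,417} : Finset (ZMod 505)),
   ({0,9,26,85,357,428,490} : Finset (ZMod 505)),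
   ({0,10,170,310,391,455,492} : Finset (ZMod 505)),
   ({0,11,93,113,279,384,422} : Finset (ZMod 505)),
   ({0,14,161,290,368,421,477} : Finset (ZMod 505)),
   ({0,16,89,158,273,327,453} : Finset (ZMod 505)),
   ({0,18,45,79,217,304,371} : Finset (ZMod 505)),
   ({0,21,43,149,206,317,456} : Finset (ZMod 505)),
   ({0,25,135,175,328,375,450} : Finset (ZMod 505)),
   ({0,30,227,258,324,431,470} : Finset (ZMod 505))]

section DifferenceFamily

variable {G ι : Type*} [AddCommGroup G] [Fintype G] [DecidableEq G] [Fintype ι]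
  {B : ι → Finset G} {k : ℕ}

/-- If every nonzero element of `G` is a difference within one of the blocks, and the number of
pairs of distinct elements of a common block is at most `|G| - 1`, then these pairs are determined
by their differences. -/
theorem injOn_sub_of_cover (hcard : ∀ i, (B i).card = k)
    (hcount : Fintype.card ι * (k * k - k) = Fintype.card G - 1)
    (hcover : ∀ d : G, d ≠ 0 → ∃ i, ∃ c ∈ B i, d + c ∈ B i) :
    Set.InjOn (fun q : Σ _ : ι, G × G => q.2.1 - q.2.2)
      (Finset.univ.sigma fun i => (B i).offDiag) := by
  classical
  have himage : (Finset.univ.sigma fun i => (B i).offDiag).image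
      (fun q : Σ _ : ι, G × G => q.2.1 - q.2.2) = Finset.univ.erase 0 := by
    ext d
    simp only [Finset.mem_image, Finset.mem_sigma, Finset.mem_univ, true_and,
      Finset.mem_offDiag, Finset.mem_erase, and_true]
    constructor
    · rintro ⟨⟨i, a, c⟩, ⟨-, -, hac⟩, rfl⟩
      exact sub_ne_zero.mpr hac
    · intro hd
      obtain ⟨i, c, hc, hdc⟩ := hcover d hd
      exact ⟨⟨i, d + c, c⟩, ⟨hdc, hc, by simpa using hd⟩, by simp⟩
  refine Finset.card_image_iff.mp ?_
  rw [himage, Finset.card_erase_of_mem (Finset.mem_univ _), Finset.card_univ, ← hcount,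
    Finset.card_sigma]
  simp [Finset.offDiag_card, hcard]

/-- In a difference family, every pair of distinct elements lies in exactly one translate. -/
theorem existsUnique_translate_of_injOn_sub
    (hcover : ∀ d : G, d ≠ 0 → ∃ i, ∃ c ∈ B i, d + c ∈ B i)
    (hinj : Set.InjOn (fun q : Σ _ : ι, G × G => q.2.1 - q.2.2)
      (Finset.univ.sigma fun i => (B i).offDiag))
    {p : Finset G} (hp : p.card = 2) :
    ∃! b, b ∈ (Finset.univ.image fun ig : ι × G => (B ig.1).image (· + ig.2)) ∧ p ⊆ b := by
  obtain ⟨x, y, hxy, rfl⟩ := Finset.card_eq_two.mp hp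
  obtain ⟨i, c, hc, hdc⟩ := hcover (x - y) (sub_ne_zero.mpr hxy)
  refine ⟨(B i).image (· + (y - c)), ⟨Finset.mem_image.mpr ⟨(i, y - c), Finset.mem_univ _, rfl⟩,
    ?_⟩, ?_⟩
  · simp only [Finset.insert_subset_iff, Finset.singleton_subset_iff, Finset.mem_image]
    exact ⟨⟨x - y + c, hdc, by abel⟩, ⟨c, hc, by abel⟩⟩
  · rintro b ⟨hb, hsub⟩
    obtain ⟨⟨j, h⟩, -, rfl⟩ := Finset.mem_image.mp hb
    simp only [Finset.insert_subset_iff, Finset.singleton_subset_iff, Finset.mem_image] at hsub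
    obtain ⟨⟨u, hu, rfl⟩, ⟨v, hv, rfl⟩⟩ := hsub
    rw [add_sub_add_right_eq_sub] at hdc
    have hq := @hinj ⟨j, u, v⟩ (by simpa [hu, hv] using hxy)
      ⟨i, u - v + c, c⟩ (by simpa [hc, hdc, sub_eq_zero] using hxy) (by simp)
    simp only [Sigma.mk.injEq, heq_eq_eq, Prod.mk.injEq] at hq
    obtain ⟨rfl, -, rfl⟩ := hq
    simp

end DifferenceFamily

theorem mem_diffSet {B : Finset (ZMod 505)} {d : ZMod 505} :
    d ∈ diffSet B ↔ ∃ q ∈ B.offDiag, q.1 - q.2 = d := by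
  simp [diffSet, Finset.mem_offDiag, and_assoc]

theorem card_baseBlocks (i : Fin 12) : (baseBlocks i).card = 7 := by
  revert i
  decide +kernel

/-- The least nonnegative representatives of the elements of the base blocks. -/
def baseBlockReps : List (List ℕ) :=
  [[0, 1, 3, 7, 119, 242, 341],
   [0, 5, 51, 63, 95, 254, 287],
   [0, 8, 261, 297, 369, 388, 417],
   [0, 9, 26, 85, 357, 428, 490],
   [0, 10, 170, 310, 391, 455, 492],
   [0, 11, 93, 113, 279, 384, 422],
   [0, 14, 161, 290, 368, 421, 477],
   [0, 16, 89, 158, 273, 327, 453],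
   [0, 18, 45, 79, 217, 304, 371],
   [0, 21, 43, 149, 206, 317, 456],
   [0, 25, 135, 175, 328, 375, 450],
   [0, 30, 227, 258, 324, 431, 470]]

theorem exists_cast_mem_baseBlocks_of_mem_baseBlockReps :
    ∀ l ∈ baseBlockReps, ∃ i, ∀ n ∈ l, (n : ZMod 505) ∈ baseBlocks i := by
  decide +kernel

/-- The residues modulo `505` of all the differences `a - c` within a base block. -/
def baseBlockDiffs : List ℕ :=
  baseBlockReps.flatMap fun l => l.flatMap fun c => l.map fun a => (a + 504 * c) % 505

/-- The natural number whose binary digits are the indicator of the members of a list. -/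
def bitIndicator (L : List ℕ) : ℕ :=
  L.foldr (fun n m => 2 ^ n ||| m) 0

theorem mem_of_testBit_bitIndicator {L : List ℕ} {d : ℕ} (h : (bitIndicator L).testBit d) :
    d ∈ L := by
  induction L with
  | nil => simp [bitIndicator] at h
  | cons n L ih =>
    rw [bitIndicator, List.foldr_cons, Nat.testBit_or, Bool.or_eq_true,
      Nat.testBit_two_pow, decide_eq_true_iff] at h
    exact h.elim (fun h => h ▸ List.mem_cons_self) fun h => List.mem_cons_of_mem _ (ih h)

theorem bitIndicator_baseBlockDiffs : bitIndicator baseBlockDiffs = 2 ^ 505 - 1 := by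
  decide +kernel

theorem exists_add_mem_baseBlocks (d : ZMod 505) :
    ∃ i, ∃ c ∈ baseBlocks i, d + c ∈ baseBlocks i := by
  have hd : d.val ∈ baseBlockDiffs := mem_of_testBit_bitIndicator <| by
    rw [bitIndicator_baseBlockDiffs, Nat.testBit_two_pow_sub_one, decide_eq_true_iff]
    exact ZMod.val_lt d
  simp only [baseBlockDiffs, List.mem_flatMap, List.mem_map] at hd
  obtain ⟨l, hl, c, hc, a, ha, had⟩ := hd
  obtain ⟨i, hi⟩ := exists_cast_mem_baseBlocks_of_mem_baseBlockReps l hl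
  have hdc : d + c = a := by
    have h := congrArg (Nat.cast : ℕ → ZMod 505) had
    rw [ZMod.natCast_mod, ZMod.natCast_zmod_val] at h
    have h505 : (505 : ZMod 505) = 0 := by decide
    push_cast at h
    linear_combination -h + c * h505
  exact ⟨i, c, hi c hc, hdc ▸ hi a ha⟩

theorem injOn_sub_baseBlocks :
    Set.InjOn (fun q : Σ _ : Fin 12, ZMod 505 × ZMod 505 => q.2.1 - q.2.2)
      (Finset.univ.sigma fun i => (baseBlocks i).offDiag) :=
  injOn_sub_of_cover card_baseBlocks (by simp [ZMod.card])
    fun d _ => exists_add_mem_baseBlocks d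

/-- The given 12 base blocks form a difference family on `ℤ/505ℤ`: their difference
sets are pairwise disjoint, each has 42 elements, and their union is `ℤ/505ℤ \ {0}`;
consequently the translates `Bᵢ + g` form the block set of a Steiner system
`S(2,7,505)` on `ℤ/505ℤ`. -/
theorem difference_family_zmod_505_7 :
    (∀ i j, i ≠ j → Disjoint (diffSet (baseBlocks i)) (diffSet (baseBlocks j))) ∧
    (∀ i, (diffSet (baseBlocks i)).card = 42) ∧
    ((Finset.univ.biUnion fun i => diffSet (baseBlocks i)) = Finset.univ \ {0}) ∧
    ∀ p : Finset (ZMod 505), p.card = 2 →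
      ∃! b, b ∈ (Finset.univ.image fun ig : Fin 12 × ZMod 505 =>
          (baseBlocks ig.1).image (· + ig.2)) ∧ p ⊆ b := by
  refine ⟨fun i j hij => ?_, fun i => ?_, ?_, fun p hp =>
    existsUnique_translate_of_injOn_sub (fun d _ => exists_add_mem_baseBlocks d)
      injOn_sub_baseBlocks hp⟩
  · refine Finset.disjoint_left.mpr fun d hi hj => hij ?_
    obtain ⟨q, hq, rfl⟩ := mem_diffSet.mp hi
    obtain ⟨r, hr, hrq⟩ := mem_diffSet.mp hj
    exact congrArg Sigma.fst (@injOn_sub_baseBlocks ⟨i, q⟩ (by simpa using hq)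
      ⟨j, r⟩ (by simpa using hr) hrq.symm)
  · have himage : diffSet (baseBlocks i) = (baseBlocks i).offDiag.image fun q => q.1 - q.2 := by
      ext d
      simp only [mem_diffSet, Finset.mem_image]
    rw [himage, Finset.card_image_of_injOn, Finset.offDiag_card, card_baseBlocks]
    intro q hq r hr hqr
    simpa using @injOn_sub_baseBlocks ⟨i, q⟩ (by simpa using hq) ⟨i, r⟩ (by simpa using hr) hqr
  · ext d
    simp only [Finset.mem_biUnion, Finset.mem_univ, true_and, Finset.mem_sdiff,
      Finset.mem_singleton, mem_diffSet, Finset.mem_offDiag]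
    constructor
    · rintro ⟨i, q, ⟨-, -, hq⟩, rfl⟩
      exact sub_ne_zero.mpr hq
    · intro hd
      obtain ⟨i, c, hc, hdc⟩ := exists_add_mem_baseBlocks d
      exact ⟨i, (d + c, c), ⟨hdc, hc, by simpa using hd⟩, by simp⟩
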